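/- arXiv:1108.0117 — 4 statements merged into one kernel-verified Lean document; each statement's English description precedes it below -/
import Mathlib

section
/- Let u_1, …, u_d be linearly independent vectors in ℝ^d, let C = Σ_{i=1}^d ℝ_{≥0} u_i be the simplicial cone they generate, let s ∈ ℝ^d, and let ℓ ∈ ℝ^d be a linear form with ⟨ℓ, u_i⟩ < 0 for all i. Then the function x ↦ e^{⟨ℓ, x⟩} is Lebesgue integrable over the shifted cone s + C and ∫_{s+C} e^{⟨ℓ, x⟩} dx = |det(u_1, …, u_d)| · e^{⟨ℓ, s⟩} · ∏_{i=1}^d 1/⟨−ℓ, u_i⟩. -/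
open MeasureTheory
open scoped RealInnerProductSpace

/-- The exponential of a sum of linear functions with negative slopes is integrable over the
nonnegative orthant, and its integral is a product of one-dimensional integrals. -/
theorem integral_exp_sum_mul_nonneg_orthant {ι : Type*} [Fintype ι] (a : ι → ℝ)
    (ha : ∀ i, a i < 0) :
    IntegrableOn (fun t : EuclideanSpace ℝ ι => Real.exp (∑ i, a i * t i))
      {t | ∀ i, 0 ≤ t i} ∧
    ∫ t in {t : EuclideanSpace ℝ ι | ∀ i, 0 ≤ t i}, Real.exp (∑ i, a i * t i) =
      ∏ i, 1 / (-a i) := by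
  have hpre : (WithLp.toLp 2 : (ι → ℝ) → EuclideanSpace ℝ ι) ⁻¹' {t | ∀ i, 0 ≤ t i} =
      Set.univ.pi fun _ => Set.Ici 0 := by
    ext t
    simp [Pi.le_def]
  have hmp := PiLp.volume_preserving_toLp ι
  have hemb := (MeasurableEquiv.toLp 2 (ι → ℝ)).measurableEmbedding
  rw [← hmp.integrableOn_comp_preimage hemb, ← hmp.setIntegral_preimage_emb hemb, hpre,
    IntegrableOn, volume_pi, Measure.restrict_pi_pi]
  simp only [Function.comp_def, Real.exp_sum]
  constructor
  · exact Integrable.fintype_prod (f := fun i (x : ℝ) => Real.exp (a i * x))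
      fun i => (integrableOn_Ici_iff_integrableOn_Ioi).2 (integrableOn_exp_mul_Ioi (ha i) 0)
  · rw [integral_fintype_prod_eq_prod (fun i (x : ℝ) => Real.exp (a i * x))]
    refine Finset.prod_congr rfl fun i _ => ?_
    rw [integral_Ici_eq_integral_Ioi, integral_exp_mul_Ioi (ha i)]
    simp [neg_div, div_neg]

/-- Let `u_1, …, u_d` be linearly independent vectors in `ℝ^d`, let
`C = Σ ℝ_{≥0} u_i` be the simplicial cone they generate, let `s ∈ ℝ^d`, and let `ℓ`
be a linear form with `⟨ℓ, u_i⟩ < 0` for all `i`.  Then `x ↦ e^{⟨ℓ, x⟩}` is Lebesgue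
integrable over the shifted cone `s + C` and
`∫_{s+C} e^{⟨ℓ, x⟩} dx = |det(u_1, …, u_d)| · e^{⟨ℓ, s⟩} · ∏ 1/⟨−ℓ, u_i⟩`. -/
theorem integral_exp_inner_shifted_simplicial_cone (d : ℕ)
    (u : Fin d → EuclideanSpace ℝ (Fin d)) (hu : LinearIndependent ℝ u)
    (s ℓ : EuclideanSpace ℝ (Fin d)) (hℓ : ∀ i, ⟪ℓ, u i⟫ < 0) :
    IntegrableOn (fun x => Real.exp ⟪ℓ, x⟫)
      ((fun y => s + y) ''
        {x | ∃ t : Fin d → ℝ, (∀ i, 0 ≤ t i) ∧ x = ∑ i, t i • u i}) volume ∧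
    ∫ x in (fun y => s + y) ''
        {x | ∃ t : Fin d → ℝ, (∀ i, 0 ≤ t i) ∧ x = ∑ i, t i • u i},
        Real.exp ⟪ℓ, x⟫ =
      |(Matrix.of fun i j => u j i).det| * Real.exp ⟪ℓ, s⟫ *
        ∏ i, 1 / ⟪-ℓ, u i⟫ := by
  let M : Matrix (Fin d) (Fin d) ℝ := Matrix.of fun i j => u j i
  let L : EuclideanSpace ℝ (Fin d) →L[ℝ] EuclideanSpace ℝ (Fin d) :=
    (Matrix.toEuclideanLin M).toContinuousLinearMap
  have hL (t : EuclideanSpace ℝ (Fin d)) : L t = ∑ i, t i • u i := by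
    ext j
    simp [L, M, Matrix.mulVec, dotProduct, mul_comm]
  have hdet : L.det = M.det := by
    simp [L, ContinuousLinearMap.det, Matrix.toLpLin_eq_toLin]
  have hset : (fun y => s + y) '' {x | ∃ t : Fin d → ℝ, (∀ i, 0 ≤ t i) ∧ x = ∑ i, t i • u i} =
      (fun t => s + L t) '' {t | ∀ i, 0 ≤ t i} := by
    rw [← Set.image_image (fun y => s + y) L]
    congr 1
    ext x
    constructor
    · rintro ⟨t, ht, rfl⟩
      exact ⟨WithLp.toLp 2 t, ht, hL _⟩
    · rintro ⟨t, ht, rfl⟩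
      exact ⟨t, ht, hL t⟩
  have hinj : Function.Injective fun t => s + L t := by
    refine (add_right_injective s).comp fun t t' h => ?_
    rw [hL, hL] at h
    exact PiLp.ext fun i => congrFun
      (hu.fintypeLinearCombination_injective (by simpa [Fintype.linearCombination_apply])) i
  have hmeas : MeasurableSet {t : EuclideanSpace ℝ (Fin d) | ∀ i, 0 ≤ t i} := by
    simp only [Set.ofPred_forall]
    exact .iInter fun i => measurableSet_le measurable_const (by fun_prop)
  have hderiv : ∀ t ∈ {t : EuclideanSpace ℝ (Fin d) | ∀ i, 0 ≤ t i},
      HasFDerivWithinAt (fun t => s + L t) L {t | ∀ i, 0 ≤ t i} t :=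
    fun t _ => (L.hasFDerivAt.const_add s).hasFDerivWithinAt
  have hexp (t : EuclideanSpace ℝ (Fin d)) :
      |L.det| • Real.exp ⟪ℓ, s + L t⟫ =
        (|M.det| * Real.exp ⟪ℓ, s⟫) * Real.exp (∑ i, ⟪ℓ, u i⟫ * t i) := by
    rw [hdet, hL, inner_add_right, Real.exp_add, smul_eq_mul, mul_assoc, inner_sum]
    simp only [inner_smul_right, mul_comm]
  obtain ⟨hint, hval⟩ := integral_exp_sum_mul_nonneg_orthant _ hℓ
  rw [hset, integrableOn_image_iff_integrableOn_abs_det_fderiv_smul volume hmeas hderiv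
    hinj.injOn, integral_image_eq_integral_abs_det_fderiv_smul volume hmeas hderiv hinj.injOn]
  simp only [hexp]
  refine ⟨hint.const_mul _, ?_⟩
  rw [integral_const_mul, hval]
  simp only [inner_neg_left, M]
end

section
/- Let P ⊆ ℝ^d be a convex set with nonempty interior that contains a straight line, i.e., there exist x_0 ∈ P and a nonzero v ∈ ℝ^d with x_0 + t·v ∈ P for all t ∈ ℝ. Then for every linear form ℓ ∈ ℝ^d, the function x ↦ e^{⟨ℓ, x⟩} is not Lebesgue integrable over P. -/
open MeasureTheory
open scoped RealInnerProductSpace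

/-- The interior of a convex set containing a line is invariant under translation along it. -/
theorem Convex.add_smul_mem_interior_of_line {E : Type*} [NormedAddCommGroup E] [NormedSpace ℝ E]
    {P : Set E} (hP : Convex ℝ P) {x₀ v : E} (hline : ∀ t : ℝ, x₀ + t • v ∈ P)
    {x : E} (hx : x ∈ interior P) (t : ℝ) : x + t • v ∈ interior P := by
  have hcont : Continuous fun s : ℝ => x + s • (x - x₀) := by fun_prop
  have hev : ∀ᶠ s in nhds (0 : ℝ), x + s • (x - x₀) ∈ interior P :=
    hcont.continuousAt.eventually_mem (isOpen_interior.mem_nhds (by simpa using hx))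
  obtain ⟨s, hsP, hs⟩ := ((hev.filter_mono nhdsWithin_le_nhds).and
    (self_mem_nhdsWithin : Set.Ioi (0 : ℝ) ∈ nhdsWithin 0 (Set.Ioi 0))).exists
  have hs : 0 < s := hs
  have hmem := hP.combo_interior_self_mem_interior hsP (hline (t * (1 + s) / s))
    (a := 1 / (1 + s)) (b := s / (1 + s)) (by positivity) (by positivity) (by field_simp)
  convert hmem using 1
  match_scalars <;> field_simp
  ring

/-- Equally spaced translates of a small ball along a nonzero vector have infinite total volume. -/
theorem volume_iUnion_ball_add_smul_eq_top {d : ℕ} (x : EuclideanSpace ℝ (Fin d))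
    {v : EuclideanSpace ℝ (Fin d)} (hv : v ≠ 0) {r : ℝ} (hr : 0 < r) :
    volume (⋃ n : ℕ, Metric.ball (x + (n * (2 * r / ‖v‖)) • v) r) = ⊤ := by
  have hv' : 0 < ‖v‖ := norm_pos_iff.mpr hv
  rw [measure_iUnion _ fun n => measurableSet_ball]
  · simp only [Measure.addHaar_ball_center volume _ r]
    exact ENNReal.tsum_const_eq_top_of_ne_zero (Metric.measure_ball_pos volume _ hr).ne'
  · intro m n hmn
    refine Metric.ball_disjoint_ball ?_
    have hone : (1 : ℝ) ≤ |(m : ℝ) - n| := by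
      exact_mod_cast Int.one_le_abs (sub_ne_zero.mpr (Int.ofNat_inj.not.mpr hmn))
    rw [dist_add_left, dist_eq_norm, ← sub_smul, norm_smul, Real.norm_eq_abs, ← sub_mul, abs_mul,
      abs_of_pos (by positivity : 0 < 2 * r / ‖v‖), mul_assoc, div_mul_cancel₀ _ hv'.ne']
    nlinarith

/-- Let `P ⊆ ℝ^d` be a convex set with nonempty interior that contains a straight
line, i.e., there exist `x₀ ∈ P` and a nonzero `v` with `x₀ + t • v ∈ P` for all
`t : ℝ`.  Then for every linear form `ℓ`, the function `x ↦ e^{⟨ℓ, x⟩}` is not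
Lebesgue integrable over `P`. -/
theorem not_integrableOn_exp_inner_of_contains_line (d : ℕ)
    (P : Set (EuclideanSpace ℝ (Fin d))) (hP : Convex ℝ P)
    (hint : (interior P).Nonempty)
    (x₀ : EuclideanSpace ℝ (Fin d)) (hx₀ : x₀ ∈ P)
    (v : EuclideanSpace ℝ (Fin d)) (hv : v ≠ 0)
    (hline : ∀ t : ℝ, x₀ + t • v ∈ P)
    (ℓ : EuclideanSpace ℝ (Fin d)) :
    ¬ IntegrableOn (fun x => Real.exp ⟪ℓ, x⟫) P volume := by
  wlog hℓ : 0 ≤ ⟪ℓ, v⟫ generalizing v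
  · refine this (-v) (neg_ne_zero.mpr hv) (fun t => ?_) ?_
    · simpa using hline (-t)
    · rw [inner_neg_right]
      linarith
  intro hf
  obtain ⟨x, hx⟩ := hint
  obtain ⟨r, hr, hball⟩ := Metric.isOpen_iff.mp isOpen_interior x hx
  set U := ⋃ n : ℕ, Metric.ball (x + (n * (2 * r / ‖v‖)) • v) r
  have hmeas : MeasurableSet U := MeasurableSet.iUnion fun n => measurableSet_ball
  have hsub : U ⊆ P := by
    refine Set.iUnion_subset fun n y hy => ?_
    have hy' : y - (n * (2 * r / ‖v‖)) • v ∈ interior P := hball <| by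
      rw [Metric.mem_ball, dist_eq_norm] at hy ⊢
      convert hy using 2
      abel
    simpa using interior_subset (hP.add_smul_mem_interior_of_line hline hy' (n * (2 * r / ‖v‖)))
  have hlower : ∀ y ∈ U, Real.exp (⟪ℓ, x⟫ - ‖ℓ‖ * r) ≤ Real.exp ⟪ℓ, y⟫ := by
    intro y hy
    obtain ⟨n, hn⟩ := Set.mem_iUnion.mp hy
    rw [Metric.mem_ball, dist_eq_norm] at hn
    have hcs := neg_le_of_abs_le
      (abs_real_inner_le_norm ℓ (y - (x + (n * (2 * r / ‖v‖)) • v)))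
    have hbound := mul_le_mul_of_nonneg_left hn.le (norm_nonneg ℓ)
    have hshift : 0 ≤ (n * (2 * r / ‖v‖)) * ⟪ℓ, v⟫ := by positivity
    rw [inner_sub_right, inner_add_right, real_inner_smul_right] at hcs
    exact Real.exp_le_exp.mpr (by linarith)
  have hconst : IntegrableOn (fun _ => Real.exp (⟪ℓ, x⟫ - ‖ℓ‖ * r)) U volume := by
    refine Integrable.mono' (hf.mono_set hsub) aestronglyMeasurable_const ?_
    filter_upwards [ae_restrict_mem hmeas] with y hy
    rw [Real.norm_of_nonneg (Real.exp_pos _).le]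
    exact hlower y hy
  rcases (integrableOn_const_iff).mp hconst with h | h
  · exact (Real.exp_pos _).ne' (enorm_eq_zero.mp h)
  · exact h.ne (volume_iUnion_ball_add_smul_eq_top x hv hr)
end

section
/- Let P ⊆ ℝ^2 be the pentagon with vertices (0,0), (2,0), (0,2), (3,1), and (1,3), i.e., P = conv{(0,0), (2,0), (0,2), (3,1), (1,3)}. Then for every nonnegative integer M and all real c_1, c_2 with c_1 ≠ 0, c_2 ≠ 0, c_1 + c_2 ≠ 0, and c_1 ≠ c_2, one has ∫_P (c_1 x + c_2 y)^M dx dy = (M!/(M+2)!) · [ (2c_1)^{M+2} / (c_1 (−c_1 − c_2)) + 4(3c_1 + c_2)^{M+2} / ((c_1 + c_2)(2c_1 − 2c_2)) + 4(c_1 + 3c_2)^{M+2} / ((c_1 + c_2)(−2c_1 + 2c_2)) + (2c_2)^{M+2} / ((−c_1 − c_2) c_2) ]. -/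
open MeasureTheory

/-- A convex set containing `0`, `u` and `v` contains the triangle they span. -/
lemma Convex.smul_add_smul_mem_of_zero_mem {E : Type*} [AddCommGroup E] [Module ℝ E]
    {s : Set E} (hs : Convex ℝ s) (h0 : (0 : E) ∈ s) {u v : E} (hu : u ∈ s) (hv : v ∈ s)
    {a b : ℝ} (ha : 0 ≤ a) (hb : 0 ≤ b) (hab : a + b ≤ 1) : a • u + b • v ∈ s := by
  have key := hs.sum_mem (t := Finset.univ) (w := ![a, b, 1 - a - b]) (z := ![u, v, 0])
    (by intro i _; fin_cases i <;> simp <;> linarith)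
    (by simp [Fin.sum_univ_three])
    (by intro i _; fin_cases i <;> simpa)
  simpa [Fin.sum_univ_three] using key

/-- The pentagon as an intersection of half-planes. -/
lemma convexHull_pentagon_eq :
    convexHull ℝ ({((0 : ℝ), (0 : ℝ)), (2, 0), (0, 2), (3, 1), (1, 3)} : Set (ℝ × ℝ)) =
      {p | p.1 ∈ Set.Icc 0 3 ∧ p.2 ∈ Set.Icc (max 0 (p.1 - 2)) (min (p.1 + 2) (4 - p.1))} := by
  apply Set.Subset.antisymm
  · refine convexHull_min ?_ ?_
    · rintro p (rfl | rfl | rfl | rfl | rfl) <;> norm_num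
    · rintro ⟨x, y⟩ hp ⟨x', y'⟩ hq a b ha hb hab
      simp only [Set.mem_ofPred_eq, Set.mem_Icc, max_le_iff, le_min_iff, Prod.smul_mk, Prod.mk_add_mk,
        smul_eq_mul] at hp hq ⊢
      obtain rfl : b = 1 - a := by linarith
      refine ⟨⟨?_, ?_⟩, ⟨?_, ?_⟩, ?_, ?_⟩ <;> nlinarith
  · rintro ⟨x, y⟩ hp
    simp only [Set.mem_ofPred_eq, Set.mem_Icc, max_le_iff, le_min_iff] at hp
    obtain ⟨⟨hx0, hx3⟩, ⟨hy0, hxy⟩, hyx, hsum⟩ := hp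
    set V : Set (ℝ × ℝ) := {((0 : ℝ), (0 : ℝ)), (2, 0), (0, 2), (3, 1), (1, 3)} with hV
    have hmem : ∀ p ∈ V, p ∈ convexHull ℝ V := fun p hp ↦ subset_convexHull ℝ V hp
    have triangle : ∀ u ∈ V, ∀ v ∈ V, ∀ a b : ℝ, 0 ≤ a → 0 ≤ b → a + b ≤ 1 →
        a • u + b • v ∈ convexHull ℝ V := fun u hu v hv a b ha hb hab ↦
      (convex_convexHull ℝ V).smul_add_smul_mem_of_zero_mem (hmem 0 (Or.inl rfl))
        (hmem u hu) (hmem v hv) ha hb hab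
    rcases le_total (3 * y) x with h | h
    · convert triangle (2, 0) (by simp [hV]) (3, 1) (by simp [hV]) ((x - 3 * y) / 2) y
        (by linarith) hy0 (by linarith) using 1
      ext <;> simp <;> ring
    rcases le_total (3 * x) y with h' | h'
    · convert triangle (0, 2) (by simp [hV]) (1, 3) (by simp [hV]) ((y - 3 * x) / 2) x
        (by linarith) hx0 (by linarith) using 1
      ext <;> simp <;> ring
    · convert triangle (3, 1) (by simp [hV]) (1, 3) (by simp [hV]) ((3 * x - y) / 8)
        ((3 * y - x) / 8) (by linarith) (by linarith) (by linarith) using 1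
      ext <;> simp <;> ring

/-- Fubini for a region lying between the graphs of two functions. -/
lemma setIntegral_between_graphs {f : ℝ × ℝ → ℝ} {l u : ℝ → ℝ} {a b : ℝ} (hf : Continuous f)
    (hab : a ≤ b)
    (hlu : ∀ x ∈ Set.Icc a b, l x ≤ u x)
    (hc : IsCompact {p : ℝ × ℝ | p.1 ∈ Set.Icc a b ∧ p.2 ∈ Set.Icc (l p.1) (u p.1)}) :
    ∫ p in {p : ℝ × ℝ | p.1 ∈ Set.Icc a b ∧ p.2 ∈ Set.Icc (l p.1) (u p.1)}, f p =
      ∫ x in a..b, ∫ y in (l x)..(u x), f (x, y) := by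
  set S := {p : ℝ × ℝ | p.1 ∈ Set.Icc a b ∧ p.2 ∈ Set.Icc (l p.1) (u p.1)} with hS
  have hint : Integrable (S.indicator f) (volume.prod volume) :=
    (hf.continuousOn.integrableOn_compact (μ := volume) hc).integrable_indicator hc.measurableSet
  rw [← integral_indicator hc.measurableSet, Measure.volume_eq_prod, integral_prod _ hint,
    intervalIntegral.integral_of_le hab, ← integral_Icc_eq_integral_Ioc,
    ← integral_indicator measurableSet_Icc]
  congr 1 with x
  by_cases hx : x ∈ Set.Icc a b
  · rw [Set.indicator_of_mem hx, intervalIntegral.integral_of_le (hlu x hx),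
      ← integral_Icc_eq_integral_Ioc, ← integral_indicator measurableSet_Icc]
    congr 1 with y
    by_cases hy : y ∈ Set.Icc (l x) (u x)
    · rw [Set.indicator_of_mem hy, Set.indicator_of_mem (show (x, y) ∈ S from ⟨hx, hy⟩)]
    · rw [Set.indicator_of_notMem hy, Set.indicator_of_notMem fun h : (x, y) ∈ S ↦ hy h.2]
  · rw [Set.indicator_of_notMem hx]
    simp [Set.indicator_of_notMem fun h : (x, _) ∈ S ↦ hx h.1]

lemma integral_affine_pow (n : ℕ) {s : ℝ} (hs : s ≠ 0) (t a b : ℝ) :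
    ∫ x in a..b, (s * x + t) ^ n =
      ((s * b + t) ^ (n + 1) - (s * a + t) ^ (n + 1)) / (s * (n + 1)) := by
  rw [intervalIntegral.integral_comp_mul_add (fun x ↦ x ^ n) hs t, integral_pow, smul_eq_mul]
  field_simp

/-- Let `P ⊆ ℝ²` be the pentagon with vertices `(0,0), (2,0), (0,2), (3,1), (1,3)`.
For every nonnegative integer `M` and all reals `c₁, c₂` with `c₁ ≠ 0`, `c₂ ≠ 0`,
`c₁ + c₂ ≠ 0` and `c₁ ≠ c₂` (i.e. `(c₁, c₂)` is not perpendicular to any edge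
direction of the pentagon),
`∫_P (c₁ x + c₂ y)^M = (M!/(M+2)!) · [ (2c₁)^{M+2}/(c₁(−c₁−c₂))
  + 4(3c₁+c₂)^{M+2}/((c₁+c₂)(2c₁−2c₂)) + 4(c₁+3c₂)^{M+2}/((c₁+c₂)(−2c₁+2c₂))
  + (2c₂)^{M+2}/((−c₁−c₂)c₂) ]`. -/
theorem pentagon_integral_pow_linear_form (M : ℕ) (c₁ c₂ : ℝ)
    (h1 : c₁ ≠ 0) (h2 : c₂ ≠ 0) (h3 : c₁ + c₂ ≠ 0) (h4 : c₁ ≠ c₂) :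
    ∫ p in convexHull ℝ
        ({((0 : ℝ), (0 : ℝ)), (2, 0), (0, 2), (3, 1), (1, 3)} : Set (ℝ × ℝ)),
        (c₁ * p.1 + c₂ * p.2) ^ M =
      ((M.factorial : ℝ) / ((M + 2).factorial : ℝ)) *
        ((2 * c₁) ^ (M + 2) / (c₁ * (-c₁ - c₂)) +
          4 * (3 * c₁ + c₂) ^ (M + 2) / ((c₁ + c₂) * (2 * c₁ - 2 * c₂)) +
          4 * (c₁ + 3 * c₂) ^ (M + 2) / ((c₁ + c₂) * (-2 * c₁ + 2 * c₂)) +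
          (2 * c₂) ^ (M + 2) / ((-c₁ - c₂) * c₂)) := by
  have hpow (n : ℕ) (u : ℝ → ℝ) (hu : Continuous u) (a b : ℝ) :
      IntervalIntegrable (fun x ↦ (c₁ * x + c₂ * u x) ^ n) volume a b :=
    Continuous.intervalIntegrable (by fun_prop) a b
  have hdiff : c₁ - c₂ ≠ 0 := sub_ne_zero.mpr h4
  have upper : ∫ x in (0 : ℝ)..3, (c₁ * x + c₂ * min (x + 2) (4 - x)) ^ (M + 1) =
      ((c₁ + 3 * c₂) ^ (M + 2) - (2 * c₂) ^ (M + 2)) / ((c₁ + c₂) * (M + 2)) +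
        ((3 * c₁ + c₂) ^ (M + 2) - (c₁ + 3 * c₂) ^ (M + 2)) / ((c₁ - c₂) * (M + 2)) := by
    have left : ∫ x in (0 : ℝ)..1, (c₁ * x + c₂ * min (x + 2) (4 - x)) ^ (M + 1) =
        ∫ x in (0 : ℝ)..1, ((c₁ + c₂) * x + 2 * c₂) ^ (M + 1) := by
      refine intervalIntegral.integral_congr fun x hx ↦ ?_
      rw [Set.uIcc_of_le (by norm_num)] at hx
      simp only [min_eq_left (show x + 2 ≤ 4 - x by linarith [hx.2])]
      ring
    have right : ∫ x in (1 : ℝ)..3, (c₁ * x + c₂ * min (x + 2) (4 - x)) ^ (M + 1) =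
        ∫ x in (1 : ℝ)..3, ((c₁ - c₂) * x + 4 * c₂) ^ (M + 1) := by
      refine intervalIntegral.integral_congr fun x hx ↦ ?_
      rw [Set.uIcc_of_le (by norm_num)] at hx
      simp only [min_eq_right (show 4 - x ≤ x + 2 by linarith [hx.1])]
      ring
    rw [← intervalIntegral.integral_add_adjacent_intervals
      (hpow _ _ (by fun_prop) 0 1) (hpow _ _ (by fun_prop) 1 3), left, right,
      integral_affine_pow _ h3, integral_affine_pow _ hdiff]
    push_cast
    ring_nf
  have lower : ∫ x in (0 : ℝ)..3, (c₁ * x + c₂ * max 0 (x - 2)) ^ (M + 1) =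
      (2 * c₁) ^ (M + 2) / (c₁ * (M + 2)) +
        ((3 * c₁ + c₂) ^ (M + 2) - (2 * c₁) ^ (M + 2)) / ((c₁ + c₂) * (M + 2)) := by
    have left : ∫ x in (0 : ℝ)..2, (c₁ * x + c₂ * max 0 (x - 2)) ^ (M + 1) =
        ∫ x in (0 : ℝ)..2, (c₁ * x + 0) ^ (M + 1) := by
      refine intervalIntegral.integral_congr fun x hx ↦ ?_
      rw [Set.uIcc_of_le (by norm_num)] at hx
      simp only [max_eq_left (show x - 2 ≤ 0 by linarith [hx.2]), mul_zero]
    have right : ∫ x in (2 : ℝ)..3, (c₁ * x + c₂ * max 0 (x - 2)) ^ (M + 1) =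
        ∫ x in (2 : ℝ)..3, ((c₁ + c₂) * x + -2 * c₂) ^ (M + 1) := by
      refine intervalIntegral.integral_congr fun x hx ↦ ?_
      rw [Set.uIcc_of_le (by norm_num)] at hx
      simp only [max_eq_right (show 0 ≤ x - 2 by linarith [hx.1])]
      ring
    rw [← intervalIntegral.integral_add_adjacent_intervals
      (hpow _ _ (by fun_prop) 0 2) (hpow _ _ (by fun_prop) 2 3), left, right,
      integral_affine_pow _ h1, integral_affine_pow _ h3]
    simp only [mul_zero, add_zero, zero_pow (Nat.succ_ne_zero _), sub_zero]
    push_cast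
    ring_nf
  have inner (x : ℝ) :
      ∫ y in (max 0 (x - 2))..(min (x + 2) (4 - x)), (c₁ * x + c₂ * y) ^ M =
        ((c₁ * x + c₂ * min (x + 2) (4 - x)) ^ (M + 1) -
          (c₁ * x + c₂ * max 0 (x - 2)) ^ (M + 1)) / (c₂ * (M + 1)) := by
    simp only [add_comm (c₁ * x)]
    exact integral_affine_pow M h2 _ _ _
  have hcompact := (Set.toFinite
    ({((0 : ℝ), (0 : ℝ)), (2, 0), (0, 2), (3, 1), (1, 3)} : Set (ℝ × ℝ))).isCompact_convexHull ℝ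
  rw [convexHull_pentagon_eq] at hcompact ⊢
  rw [setIntegral_between_graphs (l := fun x ↦ max 0 (x - 2))
    (u := fun x ↦ min (x + 2) (4 - x)) (by fun_prop) (by norm_num)
    (fun x hx ↦ by
      simp only [max_le_iff, le_min_iff]
      refine ⟨⟨?_, ?_⟩, ?_, ?_⟩ <;> linarith [hx.1, hx.2]) hcompact]
  simp only [inner]
  rw [intervalIntegral.integral_div, intervalIntegral.integral_sub
    (hpow _ _ (by fun_prop) 0 3) (hpow _ _ (by fun_prop) 0 3), upper, lower]
  have hfact : ((M + 2).factorial : ℝ) = (M + 2) * ((M + 1) * M.factorial) := by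
    rw [Nat.factorial_succ, Nat.factorial_succ]
    push_cast
    ring
  have hM : (M.factorial : ℝ) ≠ 0 := by positivity
  have e1 : -c₁ - c₂ = -(c₁ + c₂) := by ring
  have e2 : 2 * c₁ - 2 * c₂ = 2 * (c₁ - c₂) := by ring
  have e3 : -2 * c₁ + 2 * c₂ = -(2 * (c₁ - c₂)) := by ring
  rw [hfact, e1, e2, e3]
  generalize (2 * c₁) ^ (M + 2) = A
  generalize (2 * c₂) ^ (M + 2) = B
  generalize (3 * c₁ + c₂) ^ (M + 2) = C
  generalize (c₁ + 3 * c₂) ^ (M + 2) = D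
  field_simp
  ring
end

section
/- Let Q ⊆ ℝ^5 be the set of points (n_1, n_2, n_3, n_4, n_5) satisfying n_i ≥ 0 for i = 1, …, 5, n_1 + n_2 + n_3 + n_4 + n_5 ≤ 1, n_1 + n_2 > n_3 + n_4, n_3 + n_4 > n_5 + n_6, and n_1 + n_2 + n_5 < 1/2, where n_6 := 1 − (n_1 + n_2 + n_3 + n_4 + n_5). Then the 5-dimensional Lebesgue measure of Q equals 71/414720. Consequently, multiplying by 6 and dividing by the normalized volume 1/5! of the standard simplex, the asymptotic probability that simple plurality and plurality runoff give different winners in a three-candidate election is 6 · 120 · (71/414720) = 71/576 ≈ 12.33%. -/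
open MeasureTheory

/-- Tonelli for functions on `Fin (n + 1) → ℝ`, splitting off the first coordinate. -/
theorem lintegral_fin_cons {n : ℕ} {f : (Fin (n + 1) → ℝ) → ENNReal} (hf : Measurable f) :
    ∫⁻ x, f x = ∫⁻ t, ∫⁻ y : Fin n → ℝ, f (Fin.cons t y) := by
  have hmp := (volume_preserving_piFinSuccAbove (fun _ : Fin (n + 1) => ℝ) 0).symm
  rw [← hmp.lintegral_comp hf, Measure.volume_eq_prod]
  refine (lintegral_prod _ (hf.comp (MeasurableEquiv.measurable _)).aemeasurable).trans ?_
  simp [MeasurableEquiv.piFinSuccAbove, Fin.insertNthEquiv]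

theorem measurable_fin_cons {n : ℕ} (t : ℝ) :
    Measurable (fun y : Fin n → ℝ => (Fin.cons t y : Fin (n + 1) → ℝ)) :=
  measurable_pi_iff.2 fun i => by
    refine Fin.cases ?_ (fun j => ?_) i
    · simp
    · simpa using measurable_pi_apply j

theorem lintegral_fin_five {f : (Fin 5 → ℝ) → ENNReal} (hf : Measurable f) :
    ∫⁻ x, f x = ∫⁻ a, ∫⁻ b, ∫⁻ c, ∫⁻ d, ∫⁻ e, f ![a, b, c, d, e] := by
  rw [lintegral_fin_cons hf]
  refine lintegral_congr fun a => ?_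
  have h₁ := hf.comp (measurable_fin_cons a)
  refine (lintegral_fin_cons h₁).trans (lintegral_congr fun b => ?_)
  have h₂ := h₁.comp (measurable_fin_cons b)
  refine (lintegral_fin_cons h₂).trans (lintegral_congr fun c => ?_)
  have h₃ := h₂.comp (measurable_fin_cons c)
  refine (lintegral_fin_cons h₃).trans (lintegral_congr fun d => ?_)
  have h₄ := h₃.comp (measurable_fin_cons d)
  refine (lintegral_fin_cons h₄).trans (lintegral_congr fun e => ?_)
  rw [lintegral_unique, volume_pi, Measure.pi_univ]
  simp only [Finset.univ_eq_empty, Finset.prod_empty, mul_one, Function.comp_apply]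
  congr 1

/-- The sum of two nonnegative coordinates, with Lebesgue measure on the quadrant, has
density `s` on `[0, ∞)`. -/
theorem lintegral_quadrant_add {g : ℝ → ENNReal} (hg : Measurable g) :
    ∫⁻ x in Set.Ici (0 : ℝ), ∫⁻ y in Set.Ici (0 : ℝ), g (x + y) =
      ∫⁻ s in Set.Ici (0 : ℝ), ENNReal.ofReal s * g s := by
  have key (x : ℝ) : ∫⁻ y in Set.Ici (0 : ℝ), g (x + y) =
      ∫⁻ s, (Set.Ici x).indicator g s := by
    rw [← lintegral_add_left_eq_self ((Set.Ici x).indicator g) x, ← lintegral_indicator measurableSet_Ici]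
    refine lintegral_congr fun y => ?_
    simp [Set.indicator_apply]
  simp_rw [key]
  rw [lintegral_lintegral_swap, ← lintegral_indicator measurableSet_Ici]
  · refine lintegral_congr fun s => ?_
    have h (x : ℝ) : (Set.Ici x).indicator g s = (Set.Iic s).indicator (fun _ => g s) x := by
      simp [Set.indicator_apply]
    simp_rw [h]
    rw [lintegral_indicator_const measurableSet_Iic, Measure.restrict_apply measurableSet_Iic,
      Set.inter_comm, Set.Ici_inter_Iic, Real.volume_Icc, sub_zero, mul_comm]
    by_cases hs : 0 ≤ s
    · simp [hs]
    · simp [hs, ENNReal.ofReal_of_nonpos (not_le.1 hs).le]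
  · refine Measurable.aemeasurable ?_
    exact (hg.comp measurable_snd).indicator
      (measurableSet_le measurable_fst measurable_snd : MeasurableSet {p : ℝ × ℝ | p.1 ≤ p.2})

theorem lintegral_Ioo_ofReal {f : ℝ → ℝ} {a b : ℝ} (hab : a ≤ b) (hf : Continuous f)
    (h : ∀ x ∈ Set.Ioo a b, 0 ≤ f x) :
    ∫⁻ x in Set.Ioo a b, ENNReal.ofReal (f x) = ENNReal.ofReal (∫ x in a..b, f x) := by
  rw [intervalIntegral.integral_of_le hab, integral_Ioc_eq_integral_Ioo]
  refine (ofReal_integral_eq_lintegral_ofReal ?_ ?_).symm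
  · exact (hf.integrableOn_Icc).mono_set Set.Ioo_subset_Icc_self
  · exact (ae_restrict_mem measurableSet_Ioo).mono h

theorem lintegral_indicator_apply {α β : Type*} [MeasurableSpace α] (μ : Measure α) (A : Set β)
    (b : β) (f : β → α → ENNReal) :
    ∫⁻ x, A.indicator (fun b => f b x) b ∂μ = A.indicator (fun b => ∫⁻ x, f b x ∂μ) b := by
  by_cases hb : b ∈ A <;> simp [hb]

/-- The area, in the quadrant, of the strip `(1 - a) / 2 < x + y < a`, times `1 / 2 - a`. -/
theorem lintegral_strip (a : ℝ) :
    ∫⁻ x in Set.Ici (0 : ℝ), ∫⁻ y in Set.Ici (0 : ℝ),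
        (Set.Ioo ((1 - a) / 2) a).indicator (fun _ => ENNReal.ofReal (1 / 2 - a)) (x + y) =
      (Set.Ioo (1 / 3) (1 / 2)).indicator
        (fun a : ℝ => ENNReal.ofReal ((1 / 2 - a) * ((3 * a - 1) * (a + 1) / 8))) a := by
  rw [lintegral_quadrant_add (measurable_const.indicator measurableSet_Ioo)]
  rcases le_or_gt (1 / 2) a with h2 | h2
  · have : ENNReal.ofReal (1 / 2 - a) = 0 := ENNReal.ofReal_of_nonpos (by linarith)
    simp only [this, Set.indicator_zero, mul_zero, lintegral_zero]
    rw [Set.indicator_of_notMem (fun h => by linarith [h.2])]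
  rcases le_or_gt a (1 / 3) with h3 | h3
  · rw [Set.Ioo_eq_empty (by linarith), Set.indicator_of_notMem (fun h => by linarith [h.1])]
    simp
  have h (s : ℝ) : ENNReal.ofReal s *
      (Set.Ioo ((1 - a) / 2) a).indicator (fun _ => ENNReal.ofReal (1 / 2 - a)) s =
      (Set.Ioo ((1 - a) / 2) a).indicator (fun s => ENNReal.ofReal (s * (1 / 2 - a))) s := by
    by_cases hs : s ∈ Set.Ioo ((1 - a) / 2) a
    · rw [Set.indicator_of_mem hs, Set.indicator_of_mem hs,
        ENNReal.ofReal_mul' (by linarith)]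
    · rw [Set.indicator_of_notMem hs, Set.indicator_of_notMem hs, mul_zero]
  simp_rw [h]
  rw [setLIntegral_indicator measurableSet_Ioo, Set.inter_eq_left.2
    (fun s hs => by have := hs.1; simp only [Set.mem_Ici]; linarith),
    lintegral_Ioo_ofReal (by linarith) (by fun_prop)
      (fun s hs => mul_nonneg (by linarith [hs.1]) (by linarith)),
    Set.indicator_of_mem (show a ∈ Set.Ioo (1 / 3) (1 / 2) from ⟨h3, h2⟩), intervalIntegral.integral_mul_const, integral_id]
  congr 1
  ring

/-- Let `Q ⊆ ℝ⁵` be the set of points `(n₁, …, n₅)` with `nᵢ ≥ 0`,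
`n₁ + ⋯ + n₅ ≤ 1`, `n₁ + n₂ > n₃ + n₄`, `n₃ + n₄ > n₅ + n₆` and
`n₁ + n₂ + n₅ < 1/2`, where `n₆ := 1 − (n₁ + ⋯ + n₅)`.  Then the 5-dimensional
Lebesgue measure of `Q` equals `71/414720`.  Consequently, multiplying by `6` and
dividing by the volume `1/5! = 1/120` of the standard simplex, the asymptotic
probability that simple plurality and plurality runoff give different winners in a
three-candidate election is `6 · 120 · (71/414720) = 71/576 ≈ 12.33%`. -/
theorem three_candidate_runoff_volume :
    volume {x : Fin 5 → ℝ |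
        (∀ i, 0 ≤ x i) ∧
        (∑ i, x i) ≤ 1 ∧
        x 0 + x 1 > x 2 + x 3 ∧
        x 2 + x 3 > x 4 + (1 - ∑ i, x i) ∧
        x 0 + x 1 + x 4 < 1 / 2} = ENNReal.ofReal (71 / 414720) ∧
      (6 * 120 * (71 / 414720 : ℚ) = 71 / 576) := by
  refine ⟨?_, by norm_num⟩
  set S := {x : Fin 5 → ℝ | (∀ i, 0 ≤ x i) ∧ (∑ i, x i) ≤ 1 ∧ x 0 + x 1 > x 2 + x 3 ∧
    x 2 + x 3 > x 4 + (1 - ∑ i, x i) ∧ x 0 + x 1 + x 4 < 1 / 2} with hS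
  have hm : MeasurableSet S := by
    refine measurableSet_setOfPred.2 (.and (.forall fun i => ?_) (.and ?_ (.and ?_ (.and ?_ ?_))))
    · exact measurableSet_setOfPred.1 (measurableSet_le (by fun_prop) (by fun_prop))
    · exact measurableSet_setOfPred.1 (measurableSet_le (by fun_prop) (by fun_prop))
    all_goals exact measurableSet_setOfPred.1 (measurableSet_lt (by fun_prop) (by fun_prop))
  have hfib (a b c d e : ℝ) : S.indicator (1 : (Fin 5 → ℝ) → ENNReal) ![a, b, c, d, e] =
      (Set.Ici 0).indicator (fun a => (Set.Ici 0).indicator (fun b =>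
        (Set.Ici 0).indicator (fun c => (Set.Ici 0).indicator (fun d =>
          (Set.Ioo ((1 - (a + b)) / 2) (a + b)).indicator (fun _ =>
            (Set.Ico 0 (1 / 2 - (a + b))).indicator 1 e) (c + d)) d) c) b) a := by
    simp only [Set.indicator_apply, ← ite_and, Pi.one_apply]
    refine if_congr ?_ rfl rfl
    simp only [hS, Set.mem_ofPred_eq, Fin.forall_fin_succ, Fin.sum_univ_five, Set.mem_Ici,
      Set.mem_Ioo, Set.mem_Ico]
    simp
    constructor
    · rintro ⟨⟨h0, h1, h2, h3, h4⟩, h5, h6, h7, h8⟩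
      refine ⟨h0, h1, h2, h3, ⟨?_, ?_⟩, ?_, ?_⟩ <;> linarith
    · rintro ⟨h0, h1, h2, h3, ⟨h4, h5⟩, h6, h7⟩
      refine ⟨⟨h0, h1, h2, h3, h6⟩, ?_, ?_, ?_, ?_⟩ <;> linarith
  rw [← lintegral_indicator_one hm, lintegral_fin_five (measurable_one.indicator hm)]
  simp_rw [hfib, lintegral_indicator_apply, lintegral_indicator measurableSet_Ici,
    lintegral_indicator_one measurableSet_Ico, Real.volume_Ico, sub_zero, lintegral_strip]
  rw [lintegral_quadrant_add (Measurable.indicator (by fun_prop) measurableSet_Ioo)]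
  have h (s : ℝ) : ENNReal.ofReal s * (Set.Ioo (1 / 3) (1 / 2)).indicator
        (fun a : ℝ => ENNReal.ofReal ((1 / 2 - a) * ((3 * a - 1) * (a + 1) / 8))) s =
      (Set.Ioo (1 / 3) (1 / 2)).indicator
        (fun s => ENNReal.ofReal (s * ((1 / 2 - s) * ((3 * s - 1) * (s + 1) / 8)))) s := by
    by_cases hs : s ∈ Set.Ioo (1 / 3 : ℝ) (1 / 2)
    · rw [Set.indicator_of_mem hs, Set.indicator_of_mem hs,
        ← ENNReal.ofReal_mul (p := s) (by linarith [hs.1])]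
    · rw [Set.indicator_of_notMem hs, Set.indicator_of_notMem hs, mul_zero]
  simp_rw [h]
  rw [setLIntegral_indicator measurableSet_Ioo, Set.inter_eq_left.2
    (fun s hs => by have := hs.1; simp only [Set.mem_Ici]; linarith),
    lintegral_Ioo_ofReal (by norm_num) (by fun_prop) ?_]
  · have e (s : ℝ) : s * ((1 / 2 - s) * ((3 * s - 1) * (s + 1) / 8)) =
        -(1 / 16) * s ^ 1 + 1 / 4 * s ^ 2 + -(1 / 16) * s ^ 3 + -(3 / 8) * s ^ 4 := by ring
    simp_rw [e]
    congr 1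
    rw [intervalIntegral.integral_add, intervalIntegral.integral_add,
      intervalIntegral.integral_add]
    · simp only [intervalIntegral.integral_const_mul, integral_pow]
      norm_num
    all_goals exact Continuous.intervalIntegrable (by fun_prop) _ _
  · rintro s ⟨h1, h2⟩
    have h3 : 0 ≤ 1 / 2 - s := by linarith
    have h4 : 0 ≤ 3 * s - 1 := by linarith
    have h5 : 0 ≤ s := by linarith
    positivity
end
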